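/- arXiv:math/0703516 — 2 statements merged into one kernel-verified Lean document; each statement's English description precedes it below -/
import Mathlib

section
/- Let f, g ∈ 𝓕, each having at least one node. Then f and g are conjugate in PLF⁺([0,1]) (i.e., there exists h ∈ PLF⁺([0,1]) with h f h⁻¹ = g) if and only if α_f = α_g and β_f = β_g (that is, there exists p ∈ ℝ such that ψ_f(s) = ψ_g(s + p mod 1) for all s ∈ 𝕊). -/
open Set Function

/-- `f` is locally affine at `x`: it agrees with an affine map on a neighbourhood of `x`. -/
def LocallyAffineAt (f : ℝ → ℝ) (x : ℝ) : Prop :=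
  ∃ a b : ℝ, ∀ᶠ y in nhds x, f y = a * y + b

/-- `x` is a node of `f`: a point of `(0,1)` at which `f` is not locally affine. -/
def IsNode (f : ℝ → ℝ) (x : ℝ) : Prop :=
  x ∈ Set.Ioo (0 : ℝ) 1 ∧ ¬ LocallyAffineAt f x

/-- Membership of the group `PLF⁺([0,1])` of orientation-preserving piecewise linear
homeomorphisms of `[0,1]` that are locally affine at all but finitely many points of `(0,1)`.
Such a homeomorphism is modelled as a map `ℝ → ℝ` that equals the identity outside `[0,1]`,
so that composition and (function) inverse model the group structure. -/
structure IsPLF (f : ℝ → ℝ) : Prop where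
  map_zero : f 0 = 0
  map_one : f 1 = 1
  strictMonoOn : StrictMonoOn f (Set.Icc 0 1)
  continuousOn : ContinuousOn f (Set.Icc 0 1)
  surjOn : Set.SurjOn f (Set.Icc 0 1) (Set.Icc 0 1)
  eq_id : ∀ x : ℝ, x ∉ Set.Icc (0 : ℝ) 1 → f x = x
  finite_nodes : {x : ℝ | IsNode f x}.Finite

/-- Membership of `𝓕`: elements of `PLF⁺([0,1])` with `f x > x` on `(0,1)`. -/
def MemF (f : ℝ → ℝ) : Prop :=
  IsPLF f ∧ ∀ x ∈ Set.Ioo (0 : ℝ) 1, x < f x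

/-- `f` has at least one node. -/
def HasNode (f : ℝ → ℝ) : Prop := ∃ x, IsNode f x

/-- The left derivative `f'₋(x)`. -/
noncomputable def leftDeriv (f : ℝ → ℝ) (x : ℝ) : ℝ := derivWithin f (Set.Iic x) x

/-- The right derivative `f'₊(x)`. -/
noncomputable def rightDeriv (f : ℝ → ℝ) (x : ℝ) : ℝ := derivWithin f (Set.Ici x) x

/-- `f*(x) = f'₊(x) / f'₋(x)`. -/
noncomputable def fstar (f : ℝ → ℝ) (x : ℝ) : ℝ := rightDeriv f x / leftDeriv f x

/-- `x_f`, the smallest node of `f` (for `f ∈ 𝓕` with at least one node). -/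
noncomputable def firstNode (f : ℝ → ℝ) : ℝ := sInf {x | IsNode f x}

/-- `y_f`, the largest node of `f`. -/
noncomputable def lastNode (f : ℝ → ℝ) : ℝ := sSup {x | IsNode f x}

/-- `α_f = f'₋(x_f)`. -/
noncomputable def alphaF (f : ℝ → ℝ) : ℝ := leftDeriv f (firstNode f)

/-- `φ_f^a(x) = ∏_{n=0}^∞ f*(fⁿ(x))` (independent of `a` as a formula; `a` only
fixes the domain `[a, f a)`). -/
noncomputable def phi (f : ℝ → ℝ) (x : ℝ) : ℝ := ∏' n : ℕ, fstar f (f^[n] x)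

/-- `ψ_f^a(s) = φ_f^a(α_f ^ s * a)`, a function on the circle `𝕊 = [0,1]/(0∼1)`,
represented by its values for `s ∈ [0,1)`. -/
noncomputable def psiA (f : ℝ → ℝ) (a s : ℝ) : ℝ := phi f (alphaF f ^ s * a)

/-- `ψ_f = ψ_f^{x_f}`. -/
noncomputable def psi (f : ℝ → ℝ) (s : ℝ) : ℝ := psiA f (firstNode f) s

/-- `f` and `g` are conjugate in `PLF⁺([0,1])`: `h f h⁻¹ = g` for some `h` in the group. -/
def IsConjPLF (f g : ℝ → ℝ) : Prop :=
  ∃ h : ℝ → ℝ, IsPLF h ∧ h ∘ f ∘ Function.invFun h = g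

/-- A corner function: a member of `𝓕` (with at least one node) all of whose nodes
lie in `[x_f, f x_f)`. -/
def CornerFun (f : ℝ → ℝ) : Prop :=
  MemF f ∧ HasNode f ∧ ∀ x, IsNode f x → x ∈ Set.Ico (firstNode f) (f (firstNode f))

open Filter Topology

/-- `f` is affine with slope `a > 0` to the left of `x` and slope `b > 0` to the right of `x`. -/
def HasSlopes (f : ℝ → ℝ) (x a b : ℝ) : Prop :=
  0 < a ∧ 0 < b ∧ (∀ᶠ y in 𝓝[≤] x, f y = f x + a * (y - x)) ∧
    ∀ᶠ y in 𝓝[≥] x, f y = f x + b * (y - x)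

theorem derivWithin_of_eventually_affine {f : ℝ → ℝ} {x a : ℝ} {s : Set ℝ}
    (hs : UniqueDiffWithinAt ℝ s x) (h : ∀ᶠ y in 𝓝[s] x, f y = f x + a * (y - x)) :
    derivWithin f s x = a := by
  have h1 : HasDerivAt (fun y => f x + a * (y - x)) a x := by
    simpa using (((hasDerivAt_id x).sub_const x).const_mul a).const_add (f x)
  exact ((h1.hasDerivWithinAt (s := s)).congr_of_eventuallyEq h (by simp)).derivWithin hs

namespace HasSlopes

variable {f g : ℝ → ℝ} {x a b c d : ℝ}

theorem leftDeriv_eq (h : HasSlopes f x a b) : leftDeriv f x = a :=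
  derivWithin_of_eventually_affine (uniqueDiffWithinAt_Iic x) h.2.2.1

theorem rightDeriv_eq (h : HasSlopes f x a b) : rightDeriv f x = b :=
  derivWithin_of_eventually_affine (uniqueDiffWithinAt_Ici x) h.2.2.2

theorem fstar_eq (h : HasSlopes f x a b) : fstar f x = b / a := by
  rw [fstar, h.leftDeriv_eq, h.rightDeriv_eq]

theorem fstar_ne_zero (h : HasSlopes f x a b) : fstar f x ≠ 0 := by
  rw [h.fstar_eq]
  exact (div_pos h.2.1 h.1).ne'

theorem locallyAffineAt (h : HasSlopes f x a b) (h1 : fstar f x = 1) : LocallyAffineAt f x := by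
  rw [h.fstar_eq, div_eq_one_iff_eq h.1.ne'] at h1
  subst h1
  refine ⟨b, f x - b * x, ?_⟩
  rw [← nhdsLE_sup_nhdsGE x, eventually_sup]
  constructor
  · filter_upwards [h.2.2.1] with y hy
    rw [hy]; ring
  · filter_upwards [h.2.2.2] with y hy
    rw [hy]; ring

theorem comp (hf : Monotone f) (hfc : Continuous f)
    (h : HasSlopes f x a b) (h' : HasSlopes g (f x) c d) :
    HasSlopes (g ∘ f) x (c * a) (d * b) := by
  refine ⟨mul_pos h'.1 h.1, mul_pos h'.2.1 h.2.1, ?_, ?_⟩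
  · have ht : Tendsto f (𝓝[≤] x) (𝓝[≤] (f x)) :=
      hfc.continuousWithinAt.tendsto_nhdsWithin fun y hy => hf hy
    filter_upwards [h.2.2.1, ht.eventually h'.2.2.1] with y hy hy'
    simp only [Function.comp_apply]
    rw [hy', hy]; ring
  · have ht : Tendsto f (𝓝[≥] x) (𝓝[≥] (f x)) :=
      hfc.continuousWithinAt.tendsto_nhdsWithin fun y hy => hf hy
    filter_upwards [h.2.2.2, ht.eventually h'.2.2.2] with y hy hy'
    simp only [Function.comp_apply]
    rw [hy', hy]; ring

theorem fstar_comp (hf : Monotone f) (hfc : Continuous f)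
    (h : HasSlopes f x a b) (h' : HasSlopes g (f x) c d) :
    fstar (g ∘ f) x = fstar g (f x) * fstar f x := by
  rw [(h.comp hf hfc h').fstar_eq, h.fstar_eq, h'.fstar_eq, div_mul_div_comm]

theorem inverse (hgm : Monotone g) (hgc : Continuous g)
    (hl : LeftInverse g f) (hr : RightInverse g f) (h : HasSlopes f x a b) :
    HasSlopes g (f x) a⁻¹ b⁻¹ := by
  obtain ⟨ha, hb, h1, h2⟩ := h
  refine ⟨inv_pos.2 ha, inv_pos.2 hb, ?_, ?_⟩
  · have ht : Tendsto g (𝓝[≤] (f x)) (𝓝[≤] x) := by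
      have := hgc.continuousWithinAt.tendsto_nhdsWithin (s := Iic (f x)) (t := Iic (g (f x)))
        (x := f x) fun y hy => hgm hy
      rwa [hl x] at this
    filter_upwards [ht.eventually h1] with y hy
    rw [hr y] at hy
    have hy' : y - f x = a * (g y - x) := by linarith
    rw [hl x, hy']; field_simp; ring
  · have ht : Tendsto g (𝓝[≥] (f x)) (𝓝[≥] x) := by
      have := hgc.continuousWithinAt.tendsto_nhdsWithin (s := Ici (f x)) (t := Ici (g (f x)))
        (x := f x) fun y hy => hgm hy
      rwa [hl x] at this
    filter_upwards [ht.eventually h2] with y hy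
    rw [hr y] at hy
    have hy' : y - f x = b * (g y - x) := by linarith
    rw [hl x, hy']; field_simp; ring

theorem of_eventually_eq_mul (ha : 0 < a) (h : ∀ᶠ y in 𝓝 x, f y = a * y) :
    HasSlopes f x a a := by
  have h1 : ∀ᶠ y in 𝓝 x, f y = f x + a * (y - x) := by
    filter_upwards [h] with y hy
    rw [hy, h.self_of_nhds]; ring
  exact ⟨ha, ha, nhdsWithin_le_nhds h1, nhdsWithin_le_nhds h1⟩

theorem fstar_eq_one (h : HasSlopes f x a a) : fstar f x = 1 := by
  rw [h.fstar_eq, div_self h.1.ne']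

end HasSlopes

theorem LocallyAffineAt.fstar_eq_one {f : ℝ → ℝ} (hf : StrictMono f) {x : ℝ}
    (h : LocallyAffineAt f x) : fstar f x = 1 := by
  obtain ⟨a, b, h⟩ := h
  have h1 : ∀ᶠ y in 𝓝 x, f y = f x + a * (y - x) := by
    filter_upwards [h] with y hy
    rw [hy, h.self_of_nhds]; ring
  have ha : 0 < a := by
    have h2 : ∀ᶠ y in 𝓝[>] x, f y = f x + a * (y - x) := nhdsWithin_le_nhds h1
    obtain ⟨y, hy, hxy⟩ := (h2.and self_mem_nhdsWithin).exists
    have hxy : x < y := hxy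
    have := hf hxy
    by_contra! hn
    nlinarith
  exact HasSlopes.fstar_eq_one (a := a) ⟨ha, ha, nhdsWithin_le_nhds h1, nhdsWithin_le_nhds h1⟩

theorem exists_affine_on_Ioo {f : ℝ → ℝ} {u v : ℝ}
    (h : ∀ x ∈ Ioo u v, LocallyAffineAt f x) :
    ∃ a b, ∀ x ∈ Ioo u v, f x = a * x + b := by
  have hloc : ∀ x ∈ Ioo u v, ∃ a b, (∀ᶠ y in 𝓝 x, f y = a * y + b) ∧
      ∀ᶠ y in 𝓝 x, deriv f y = a := by
    intro x hx
    obtain ⟨a, b, hab⟩ := h x hx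
    refine ⟨a, b, hab, ?_⟩
    filter_upwards [hab.eventually_nhds] with y hy
    have : f =ᶠ[𝓝 y] fun z => a * z + b := hy
    rw [this.deriv_eq]
    simp
  obtain ⟨a, ha⟩ := isOpen_Ioo.exists_is_const_of_deriv_eq_zero (f := deriv f)
    (isPreconnected_Ioo (a := u) (b := v))
    (fun x hx => by
      obtain ⟨a, b, -, h2⟩ := hloc x hx
      have h2 : deriv f =ᶠ[𝓝 x] fun _ => a := h2
      exact (h2.differentiableAt_iff.2 (differentiableAt_const a)).differentiableWithinAt)
    (fun x hx => by
      obtain ⟨a, b, -, h2⟩ := hloc x hx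
      have h2 : deriv f =ᶠ[𝓝 x] fun _ => a := h2
      rw [h2.deriv_eq]; simp)
  have hd : ∀ x ∈ Ioo u v, DifferentiableAt ℝ f x := by
    intro x hx
    obtain ⟨a, b, h1, -⟩ := hloc x hx
    have h1 : f =ᶠ[𝓝 x] fun z => a * z + b := h1
    exact h1.differentiableAt_iff.2 (by fun_prop)
  obtain ⟨b, hb⟩ := isOpen_Ioo.exists_is_const_of_deriv_eq_zero (f := fun x => f x - a * x)
    (isPreconnected_Ioo (a := u) (b := v))
    (fun x hx => ((hd x hx).sub (by fun_prop)).differentiableWithinAt)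
    (fun x hx => by
      have := ((hd x hx).hasDerivAt.sub ((hasDerivAt_id x).const_mul a)).deriv
      simp only [id, mul_one] at this
      rw [ha x hx, sub_self] at this
      exact this)
  exact ⟨a, b, fun x hx => by linarith [hb x hx]⟩

theorem exists_affine_on_Icc {f : ℝ → ℝ} (hf : StrictMono f) (hc : Continuous f) {u v : ℝ}
    (huv : u < v) (h : ∀ x ∈ Ioo u v, LocallyAffineAt f x) :
    ∃ a b, 0 < a ∧ ∀ x ∈ Icc u v, f x = a * x + b := by
  obtain ⟨a, b, hab⟩ := exists_affine_on_Ioo h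
  have key : ∀ x ∈ Icc u v, f x = a * x + b := by
    have : EqOn f (fun x => a * x + b) (closure (Ioo u v)) :=
      EqOn.closure (fun x hx => hab x hx) hc (by fun_prop)
    rw [closure_Ioo huv.ne] at this
    exact fun x hx => this hx
  refine ⟨a, b, ?_, key⟩
  have := hf huv
  rw [key u ⟨le_rfl, huv.le⟩, key v ⟨huv.le, le_rfl⟩] at this
  by_contra! hn
  nlinarith

namespace IsPLF

variable {f : ℝ → ℝ}

theorem strictMono (hf : IsPLF f) : StrictMono f := by
  have h0 := hf.map_zero
  have h1 := hf.map_one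
  have key : ∀ x, (x ∈ Icc (0 : ℝ) 1 ∧ f x ∈ Icc (0 : ℝ) 1) ∨ (x ∉ Icc (0 : ℝ) 1 ∧ f x = x) := by
    intro x
    by_cases hx : x ∈ Icc (0 : ℝ) 1
    · left
      refine ⟨hx, ?_, ?_⟩
      · rw [← h0]; exact hf.strictMonoOn.monotoneOn (by simp) hx hx.1
      · rw [← h1]; exact hf.strictMonoOn.monotoneOn hx (by simp) hx.2
    · exact Or.inr ⟨hx, hf.eq_id x hx⟩
  intro x y hxy
  rcases key x with ⟨hx, hx'⟩ | ⟨hx, hx'⟩ <;> rcases key y with ⟨hy, hy'⟩ | ⟨hy, hy'⟩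
  · exact hf.strictMonoOn hx hy hxy
  · rw [hy']
    have : 1 < y := by
      by_contra! hn
      exact hy ⟨hx.1.trans hxy.le, hn⟩
    exact hx'.2.trans_lt this
  · rw [hx']
    have : x < 0 := by
      by_contra! hn
      exact hx ⟨hn, hxy.le.trans hy.2⟩
    exact this.trans_le hy'.1
  · rwa [hx', hy']

theorem surjective (hf : IsPLF f) : Surjective f := by
  intro y
  by_cases hy : y ∈ Icc (0 : ℝ) 1
  · obtain ⟨x, -, hx⟩ := hf.surjOn hy
    exact ⟨x, hx⟩
  · exact ⟨y, hf.eq_id y hy⟩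

theorem continuous (hf : IsPLF f) : Continuous f :=
  hf.strictMono.monotone.continuous_of_surjective hf.surjective

theorem mapsTo (hf : IsPLF f) : MapsTo f (Ioo 0 1) (Ioo 0 1) := fun x hx =>
  ⟨by simpa [hf.map_zero] using hf.strictMono hx.1, by simpa [hf.map_one] using hf.strictMono hx.2⟩

theorem eventually_not_isNode (hf : IsPLF f) (x : ℝ) : ∀ᶠ y in 𝓝[≠] x, ¬ IsNode f y := by
  have h := (hf.finite_nodes.subset (sdiff_subset (t := {x}))).isClosed.compl_mem_nhds
    (x := x) (by simp)
  filter_upwards [nhdsWithin_le_nhds h, self_mem_nhdsWithin] with y hy hne hn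
  exact hy ⟨hn, hne⟩

theorem exists_right_slope (hf : IsPLF f) {x : ℝ} (hx : x ∈ Ico (0 : ℝ) 1) :
    ∃ b, 0 < b ∧ ∀ᶠ y in 𝓝[≥] x, f y = f x + b * (y - x) := by
  have h1 : ∀ᶠ y in 𝓝[>] x, ¬ IsNode f y :=
    nhdsWithin_mono x (fun y hy => ne_of_gt hy) (hf.eventually_not_isNode x)
  obtain ⟨v, hv, hsub⟩ := (mem_nhdsGT_iff_exists_Ioo_subset' (u' := 1) hx.2).1
    (h1.and (Ioo_mem_nhdsGT hx.2))
  have hxv : x < v := hv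
  obtain ⟨a, b, ha, hab⟩ := exists_affine_on_Icc hf.strictMono hf.continuous hxv
    fun y hy => by
      have := hsub hy
      by_contra hn
      exact this.1 ⟨⟨hx.1.trans_lt this.2.1, this.2.2⟩, hn⟩
  refine ⟨a, ha, ?_⟩
  filter_upwards [Icc_mem_nhdsGE hxv] with y hy
  rw [hab y hy, hab x ⟨le_rfl, hxv.le⟩]; ring

theorem exists_left_slope (hf : IsPLF f) {x : ℝ} (hx : x ∈ Ioc (0 : ℝ) 1) :
    ∃ b, 0 < b ∧ ∀ᶠ y in 𝓝[≤] x, f y = f x + b * (y - x) := by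
  have h1 : ∀ᶠ y in 𝓝[<] x, ¬ IsNode f y :=
    nhdsWithin_mono x (fun y hy => ne_of_lt hy) (hf.eventually_not_isNode x)
  obtain ⟨v, hv, hsub⟩ := (mem_nhdsLT_iff_exists_Ioo_subset' (l' := 0) hx.1).1
    (h1.and (Ioo_mem_nhdsLT hx.1))
  have hxv : v < x := hv
  obtain ⟨a, b, ha, hab⟩ := exists_affine_on_Icc hf.strictMono hf.continuous hxv
    fun y hy => by
      have := hsub hy
      by_contra hn
      exact this.1 ⟨⟨this.2.1, this.2.2.trans_le hx.2⟩, hn⟩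
  refine ⟨a, ha, ?_⟩
  filter_upwards [Icc_mem_nhdsLE hxv] with y hy
  rw [hab y hy, hab x ⟨hxv.le, le_rfl⟩]; ring

theorem exists_hasSlopes (hf : IsPLF f) {x : ℝ} (hx : x ∈ Ioo (0 : ℝ) 1) :
    ∃ a b, HasSlopes f x a b := by
  obtain ⟨a, ha, h1⟩ := hf.exists_left_slope (Ioo_subset_Ioc_self hx)
  obtain ⟨b, hb, h2⟩ := hf.exists_right_slope (Ioo_subset_Ico_self hx)
  exact ⟨a, b, ha, hb, h1, h2⟩

theorem exists_eq_mul_near_zero (hf : IsPLF f) :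
    ∃ l δ, 0 < l ∧ 0 < δ ∧ ∀ x ∈ Icc 0 δ, f x = l * x := by
  obtain ⟨l, hl, h⟩ := hf.exists_right_slope (x := 0) (by simp)
  obtain ⟨δ, hδ, hsub⟩ := (mem_nhdsGE_iff_exists_Icc_subset (a := (0 : ℝ))).1 h
  exact ⟨l, δ, hl, hδ, fun x hx => by simpa [hf.map_zero] using hsub hx⟩

theorem fstar_eq_one (hf : IsPLF f) {x : ℝ} (hx : x ∈ Ioo (0 : ℝ) 1) (h : ¬ IsNode f x) :
    fstar f x = 1 := by
  refine LocallyAffineAt.fstar_eq_one hf.strictMono ?_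
  by_contra hn
  exact h ⟨hx, hn⟩

theorem fstar_ne_zero (hf : IsPLF f) {x : ℝ} (hx : x ∈ Ioo (0 : ℝ) 1) : fstar f x ≠ 0 := by
  obtain ⟨a, b, h⟩ := hf.exists_hasSlopes hx
  exact h.fstar_ne_zero

theorem exists_nodes_lt (hf : IsPLF f) : ∃ c < 1, ∀ x, IsNode f x → x < c := by
  have hfin := hf.finite_nodes
  have h1 : ∀ᶠ c in 𝓝[<] (1 : ℝ), ∀ x ∈ {x | IsNode f x}, x < c :=
    (hfin.eventually_all).2 fun x hx =>
      nhdsWithin_le_nhds (lt_mem_nhds (hx : IsNode f x).1.2)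
  obtain ⟨c, hc, hlt⟩ := (h1.and self_mem_nhdsWithin).exists
  exact ⟨c, hlt, hc⟩

end IsPLF

namespace IsPLF

variable {f : ℝ → ℝ}

theorem leftInverse_invFun (hf : IsPLF f) : LeftInverse (invFun f) f :=
  Function.leftInverse_invFun hf.strictMono.injective

theorem rightInverse_invFun (hf : IsPLF f) : RightInverse (invFun f) f :=
  Function.rightInverse_invFun hf.surjective

theorem strictMono_invFun (hf : IsPLF f) : StrictMono (invFun f) := fun x y hxy => by
  rw [← hf.strictMono.lt_iff_lt, hf.rightInverse_invFun, hf.rightInverse_invFun]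
  exact hxy

theorem continuous_invFun (hf : IsPLF f) : Continuous (invFun f) :=
  hf.strictMono_invFun.monotone.continuous_of_surjective hf.leftInverse_invFun.surjective

theorem mapsTo_invFun (hf : IsPLF f) : MapsTo (invFun f) (Ioo 0 1) (Ioo 0 1) := fun x hx => by
  constructor
  · rw [← hf.strictMono.lt_iff_lt, hf.rightInverse_invFun, hf.map_zero]
    exact hx.1
  · rw [← hf.strictMono.lt_iff_lt, hf.rightInverse_invFun, hf.map_one]
    exact hx.2

end IsPLF

theorem fstar_iterate_mul_prod {f g h : ℝ → ℝ} (hf : IsPLF f) (hg : IsPLF g)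
    (hm : Monotone h) (hc : Continuous h) (hmaps : MapsTo h (Ioo 0 1) (Ioo 0 1))
    (hs : ∀ x ∈ Ioo (0 : ℝ) 1, ∃ a b, HasSlopes h x a b) (hfg : Semiconj h f g)
    {x : ℝ} (hx : x ∈ Ioo (0 : ℝ) 1) (n : ℕ) :
    fstar h (f^[n] x) * ∏ k ∈ Finset.range n, fstar f (f^[k] x) =
      (∏ k ∈ Finset.range n, fstar g (g^[k] (h x))) * fstar h x := by
  induction n with
  | zero => simp
  | succ n ih =>
    have hy : f^[n] x ∈ Ioo (0 : ℝ) 1 := hf.mapsTo.iterate n hx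
    set y := f^[n] x with hy_def
    obtain ⟨a, b, h1⟩ := hf.exists_hasSlopes hy
    obtain ⟨a', b', h2⟩ := hs _ (hf.mapsTo hy)
    obtain ⟨c, d, h3⟩ := hs _ hy
    obtain ⟨c', d', h4⟩ := hg.exists_hasSlopes (hmaps hy)
    have e1 := h1.fstar_comp hf.strictMono.monotone hf.continuous h2
    have e2 := h3.fstar_comp hm hc h4
    rw [hfg.comp_eq, e2] at e1
    have e3 : g^[n] (h x) = h y := ((hfg.iterate_right n) x).symm
    rw [Finset.prod_range_succ, Finset.prod_range_succ, iterate_succ_apply', ← hy_def, e3]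
    linear_combination (-∏ k ∈ Finset.range n, fstar f (f^[k] x)) * e1 + fstar g (h y) * ih

namespace MemF

variable {f : ℝ → ℝ}

theorem exists_lt_iterate (hf : MemF f) {x c : ℝ} (hx : x ∈ Ioo (0 : ℝ) 1) (hc : c < 1) :
    ∃ N, ∀ n ≥ N, c < f^[n] x := by
  have hI : ∀ n, f^[n] x ∈ Ioo (0 : ℝ) 1 := fun n => hf.1.mapsTo.iterate n hx
  have hmono : Monotone fun n => f^[n] x := monotone_nat_of_le_succ fun n => by
    rw [iterate_succ_apply']
    exact (hf.2 _ (hI n)).le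
  have hbdd : BddAbove (range fun n => f^[n] x) := ⟨1, by
    rintro _ ⟨n, rfl⟩
    exact (hI n).2.le⟩
  have ht := tendsto_atTop_ciSup hmono hbdd
  have hfix := isFixedPt_of_tendsto_iterate ht hf.1.continuous.continuousAt
  have h0 : 0 < ⨆ n, f^[n] x := hx.1.trans_le (le_ciSup hbdd 0)
  have h1 : 1 ≤ ⨆ n, f^[n] x := by
    by_contra! hlt
    exact (hf.2 _ ⟨h0, hlt⟩).ne' hfix
  exact eventually_atTop.1 (ht.eventually (lt_mem_nhds (hc.trans_le h1)))

theorem exists_iterate_invFun_lt (hf : MemF f) {x c : ℝ} (hx : x < 1)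
    (hc : c ∈ Ioo (0 : ℝ) 1) : ∃ N, ∀ n ≥ N, (invFun f)^[n] x < c := by
  obtain ⟨N, hN⟩ := hf.exists_lt_iterate hc hx
  refine ⟨N, fun n hn => ?_⟩
  rw [← (hf.1.strictMono.iterate n).lt_iff_lt, hf.1.rightInverse_invFun.iterate n]
  exact hN n hn

theorem phi_eq_prod (hf : MemF f) {x : ℝ} (hx : x ∈ Ioo (0 : ℝ) 1) {n : ℕ}
    (h : ∀ k ≥ n, ¬ IsNode f (f^[k] x)) :
    phi f x = ∏ k ∈ Finset.range n, fstar f (f^[k] x) :=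
  tprod_eq_prod fun k hk =>
    hf.1.fstar_eq_one (hf.1.mapsTo.iterate k hx) (h k (by simpa using hk))

theorem exists_not_isNode_iterate (hf : MemF f) {x : ℝ} (hx : x ∈ Ioo (0 : ℝ) 1) :
    ∃ N, ∀ n ≥ N, ∀ y ≥ x, ¬ IsNode f (f^[n] y) := by
  obtain ⟨c, hc, hlt⟩ := hf.1.exists_nodes_lt
  obtain ⟨N, hN⟩ := hf.exists_lt_iterate hx hc
  exact ⟨N, fun n hn y hy hnode =>
    ((hN n hn).trans_le ((hf.1.strictMono.iterate n).monotone hy)).not_gt (hlt _ hnode)⟩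

theorem exists_phi_eq_prod (hf : MemF f) {x : ℝ} (hx : x ∈ Ioo (0 : ℝ) 1) :
    ∃ N, ∀ n ≥ N, phi f x = ∏ k ∈ Finset.range n, fstar f (f^[k] x) := by
  obtain ⟨N, hN⟩ := hf.exists_not_isNode_iterate hx
  exact ⟨N, fun n hn => hf.phi_eq_prod hx fun k hk => hN k (hn.trans hk) x le_rfl⟩

theorem phi_ne_zero (hf : MemF f) {x : ℝ} (hx : x ∈ Ioo (0 : ℝ) 1) : phi f x ≠ 0 := by
  obtain ⟨N, hN⟩ := hf.exists_phi_eq_prod hx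
  rw [hN N le_rfl, Finset.prod_ne_zero_iff]
  exact fun k _ => hf.1.fstar_ne_zero (hf.1.mapsTo.iterate k hx)

theorem phi_eq_fstar_mul (hf : MemF f) {x : ℝ} (hx : x ∈ Ioo (0 : ℝ) 1) :
    phi f x = fstar f x * phi f (f x) := by
  obtain ⟨N, hN⟩ := hf.exists_phi_eq_prod hx
  obtain ⟨M, hM⟩ := hf.exists_phi_eq_prod (hf.1.mapsTo hx)
  rw [hN (max N M + 1) (by omega), hM (max N M) (by omega), Finset.prod_range_succ', mul_comm]
  rfl

theorem isNode_firstNode (hf : MemF f) (hn : HasNode f) : IsNode f (firstNode f) :=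
  (show Set.Nonempty {x | IsNode f x} from hn).csInf_mem hf.1.finite_nodes

theorem firstNode_le (hf : MemF f) {x : ℝ} (hx : IsNode f x) : firstNode f ≤ x :=
  csInf_le hf.1.finite_nodes.bddBelow hx

theorem eq_alphaF_mul (hf : MemF f) (hn : HasNode f) {x : ℝ} (hx : x ∈ Icc 0 (firstNode f)) :
    f x = alphaF f * x := by
  have hxf := (hf.isNode_firstNode hn).1
  obtain ⟨a, b, ha, hab⟩ := exists_affine_on_Icc hf.1.strictMono hf.1.continuous hxf.1
    fun y hy => by
      by_contra h
      exact (hf.firstNode_le ⟨⟨hy.1, hy.2.trans hxf.2⟩, h⟩).not_gt hy.2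
  have hb : b = 0 := by simpa [hf.1.map_zero] using (hab 0 ⟨le_rfl, hxf.1.le⟩).symm
  have : alphaF f = a := by
    refine derivWithin_of_eventually_affine (uniqueDiffWithinAt_Iic _) ?_
    filter_upwards [Icc_mem_nhdsLE hxf.1] with y hy
    rw [hab y hy, hab _ ⟨hxf.1.le, le_rfl⟩]; ring
  rw [this, hab x hx, hb, add_zero]

theorem one_lt_alphaF (hf : MemF f) (hn : HasNode f) : 1 < alphaF f := by
  have hxf := (hf.isNode_firstNode hn).1
  have := hf.2 _ hxf
  rw [hf.eq_alphaF_mul hn ⟨hxf.1.le, le_rfl⟩] at this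
  exact (lt_mul_iff_one_lt_left hxf.1).1 this

theorem phi_alphaF_rpow (hf : MemF f) (hn : HasNode f) {s : ℝ} (hs : s ≤ 0) :
    phi f (alphaF f ^ s * firstNode f) = psi f (Int.fract s) := by
  have hxf := (hf.isNode_firstNode hn).1
  have hα := hf.one_lt_alphaF hn
  have hα0 : 0 < alphaF f := one_pos.trans hα
  have key : ∀ n : ℕ, ∀ t < (1 : ℝ), phi f (alphaF f ^ (t - n) * firstNode f) =
      phi f (alphaF f ^ t * firstNode f) := by
    intro n
    induction n with
    | zero => simp
    | succ n ih =>
      intro t ht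
      rw [← ih t ht]
      set y := alphaF f ^ (t - (n + 1 : ℕ)) * firstNode f with hy
      have hy0 : 0 < y := mul_pos (Real.rpow_pos_of_pos hα0 _) hxf.1
      have hlt : y < firstNode f := by
        refine mul_lt_of_lt_one_left hxf.1 (Real.rpow_lt_one_of_one_lt_of_neg hα ?_)
        push_cast
        have : (0 : ℝ) ≤ n := n.cast_nonneg
        linarith
      have hyI : y ∈ Ioo (0 : ℝ) 1 := ⟨hy0, hlt.trans hxf.2⟩
      rw [hf.phi_eq_fstar_mul hyI, hf.1.fstar_eq_one hyI
        fun h => (hf.firstNode_le h).not_gt hlt, one_mul,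
        hf.eq_alphaF_mul hn ⟨hy0.le, hlt.le⟩, hy, ← mul_assoc]
      rw [mul_comm (alphaF f), ← Real.rpow_add_one hα0.ne']
      congr 3
      push_cast; ring
  obtain ⟨m, hm⟩ := Int.eq_ofNat_of_zero_le (show 0 ≤ -⌊s⌋ by
    have := Int.floor_le_floor hs
    simp at this
    simpa using this)
  have hm' : (m : ℝ) = -⌊s⌋ := by
    have : ((-⌊s⌋ : ℤ) : ℝ) = ((m : ℤ) : ℝ) := by rw [hm]
    simpa using this.symm
  have := key m (Int.fract s) (Int.fract_lt_one s)
  rw [hm', sub_neg_eq_add, Int.fract_add_floor] at this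
  exact this

end MemF

theorem exists_semiconj_of_linear_near_zero {f g : ℝ → ℝ} (hf : MemF f) (hg : MemF g) {l ε : ℝ}
    (hl : 0 < l) (hε : 0 < ε) (hε1 : ε < 1) (hlε : l * ε < 1)
    (hconj : ∀ x ∈ Icc 0 ε, g (l * x) = l * f x) :
    ∃ h : ℝ → ℝ, StrictMono h ∧ Surjective h ∧ MapsTo h (Ioo 0 1) (Ioo 0 1) ∧
      (∀ x ∉ Ioo (0 : ℝ) 1, h x = x) ∧ (∀ x ∈ Icc 0 ε, h x = l * x) ∧ Semiconj h f g := by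
  classical
  set F : ℕ → ℝ → ℝ := fun n x => g^[n] (l * (invFun f)^[n] x) with hF
  have hlt : ∀ x ∈ Ioo (0 : ℝ) 1, invFun f x < x := fun x hx => by
    have := hf.2 _ (hf.1.mapsTo_invFun hx)
    rwa [hf.1.rightInverse_invFun] at this
  have hI : ∀ n, ∀ x ∈ Ioo (0 : ℝ) 1, (invFun f)^[n] x ∈ Ioo (0 : ℝ) 1 :=
    fun n x hx => hf.1.mapsTo_invFun.iterate n hx
  have hstep : ∀ n, ∀ x ∈ Ioo (0 : ℝ) 1, (invFun f)^[n] x ≤ ε →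
      (invFun f)^[n + 1] x ≤ ε ∧ F (n + 1) x = F n x := by
    intro n x hx hn
    have h1 := hlt _ (hI n x hx)
    have h2 := (hI (n + 1) x hx).1
    rw [iterate_succ_apply'] at h2
    simp only [hF]
    rw [iterate_succ_apply' (invFun f), iterate_succ_apply g]
    refine ⟨h1.le.trans hn, ?_⟩
    rw [hconj _ ⟨h2.le, h1.le.trans hn⟩, hf.1.rightInverse_invFun]
  have hconst : ∀ n, ∀ x ∈ Ioo (0 : ℝ) 1, (invFun f)^[n] x ≤ ε → ∀ k,
      (invFun f)^[n + k] x ≤ ε ∧ F (n + k) x = F n x := by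
    intro n x hx hn k
    induction k with
    | zero => exact ⟨hn, rfl⟩
    | succ k ih =>
      obtain ⟨h1, h2⟩ := hstep (n + k) x hx ih.1
      exact ⟨h1, h2.trans ih.2⟩
  have hex : ∀ x, ∃ N, x ∈ Ioo (0 : ℝ) 1 → ∀ n ≥ N, (invFun f)^[n] x < ε := by
    intro x
    by_cases hx : x ∈ Ioo (0 : ℝ) 1
    · obtain ⟨N, hN⟩ := hf.exists_iterate_invFun_lt hx.2 ⟨hε, hε1⟩
      exact ⟨N, fun _ => hN⟩
    · exact ⟨0, fun h => (hx h).elim⟩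
  choose N hN using hex
  set h : ℝ → ℝ := fun x => if x ∈ Ioo (0 : ℝ) 1 then F (N x) x else x with hh
  have hout : ∀ x ∉ Ioo (0 : ℝ) 1, h x = x := fun x hx => if_neg hx
  have hin : ∀ n, ∀ x ∈ Ioo (0 : ℝ) 1, (invFun f)^[n] x ≤ ε → h x = F n x := by
    intro n x hx hn
    have h1 := (hconst n x hx hn (N x)).2
    have h2 := (hconst (N x) x hx (hN x hx _ le_rfl).le n).2
    rw [add_comm, h1] at h2
    rw [h2]
    exact if_pos hx
  have hFmono : ∀ n, StrictMono (F n) := fun n x y hxy =>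
    hg.1.strictMono.iterate n
      (mul_lt_mul_of_pos_left (hf.1.strictMono_invFun.iterate n hxy) hl)
  have hmaps : MapsTo h (Ioo 0 1) (Ioo 0 1) := by
    intro x hx
    have h1 := (hN x hx _ le_rfl).le
    rw [hin _ x hx h1]
    have h2 := (hI (N x) x hx).1
    exact hg.1.mapsTo.iterate _ ⟨mul_pos hl h2, (mul_le_mul_of_nonneg_left h1 hl.le).trans_lt hlε⟩
  refine ⟨h, ?_, ?_, hmaps, hout, ?_, ?_⟩
  · intro x y hxy
    by_cases hx : x ∈ Ioo (0 : ℝ) 1 <;> by_cases hy : y ∈ Ioo (0 : ℝ) 1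
    · rw [hin (max (N x) (N y)) x hx (hN x hx _ (le_max_left _ _)).le,
        hin (max (N x) (N y)) y hy (hN y hy _ (le_max_right _ _)).le]
      exact hFmono _ hxy
    · rw [hout y hy]
      refine (hmaps hx).2.trans_le ?_
      by_contra! hn
      exact hy ⟨hx.1.trans hxy, hn⟩
    · rw [hout x hx]
      refine lt_of_le_of_lt ?_ (hmaps hy).1
      by_contra! hn
      exact hx ⟨hn, hxy.trans hy.2⟩
    · rwa [hout x hx, hout y hy]
  · intro z
    by_cases hz : z ∈ Ioo (0 : ℝ) 1
    · obtain ⟨n, hn⟩ := hg.exists_iterate_invFun_lt hz.2 ⟨mul_pos hl hε, hlε⟩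
      have hn := hn n le_rfl
      have hw0 : 0 < (invFun g)^[n] z := (hg.1.mapsTo_invFun.iterate n hz).1
      have hwε : l⁻¹ * (invFun g)^[n] z < ε := by
        rwa [inv_mul_lt_iff₀ hl]
      have hx := hf.1.mapsTo.iterate n
        (show l⁻¹ * (invFun g)^[n] z ∈ Ioo (0 : ℝ) 1 from ⟨by positivity, hwε.trans hε1⟩)
      have hinv := hf.1.leftInverse_invFun.iterate n (l⁻¹ * (invFun g)^[n] z)
      refine ⟨_, (hin n _ hx (by rw [hinv]; exact hwε.le)).trans ?_⟩
      simp only [hF]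
      rw [hinv, mul_inv_cancel_left₀ hl.ne', hg.1.rightInverse_invFun.iterate n]
    · exact ⟨z, hout z hz⟩
  · intro x hx
    rcases hx.1.eq_or_lt with rfl | h0
    · rw [hout 0 (by simp), mul_zero]
    · exact hin 0 x ⟨h0, hx.2.trans_lt hε1⟩ hx.2
  · intro x
    by_cases hx : x ∈ Ioo (0 : ℝ) 1
    · have hle := (hN x hx _ le_rfl).le
      have e : (invFun f)^[N x + 1] (f x) = (invFun f)^[N x] x := by
        rw [iterate_succ_apply, hf.1.leftInverse_invFun]
      rw [hin (N x + 1) (f x) (hf.1.mapsTo hx) (by rwa [e]), hin (N x) x hx hle]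
      simp only [hF]
      rw [e, iterate_succ_apply']
    · have e : ∀ {k : ℝ → ℝ}, MemF k → k x = x := fun {k} hk => by
        by_cases hxI : x ∈ Icc (0 : ℝ) 1
        · rcases hxI.1.eq_or_lt with rfl | h0
          · exact hk.1.map_zero
          · rcases hxI.2.eq_or_lt with rfl | h1
            · exact hk.1.map_one
            · exact (hx ⟨h0, h1⟩).elim
        · exact hk.1.eq_id x hxI
      rw [hout x hx, e hf, e hg, hout x hx]

theorem isPLF_of_semiconj {f g h : ℝ → ℝ} (hf : MemF f) (hg : MemF g) {l ε : ℝ}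
    (hl : 0 < l) (hε : ε ∈ Ioo (0 : ℝ) 1) (hm : StrictMono h) (hsurj : Surjective h)
    (hmaps : MapsTo h (Ioo 0 1) (Ioo 0 1)) (hout : ∀ x ∉ Ioo (0 : ℝ) 1, h x = x)
    (hlin : ∀ x ∈ Icc 0 ε, h x = l * x) (hfg : Semiconj h f g)
    (hphi : ∀ x ∈ Ioo 0 ε, phi f x = phi g (l * x)) : IsPLF h := by
  have hc : Continuous h := hm.monotone.continuous_of_surjective hsurj
  have hsmall : ∀ x ∈ Ioo 0 ε, HasSlopes h x l l := fun x hx =>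
    HasSlopes.of_eventually_eq_mul hl (by
      filter_upwards [Icc_mem_nhds hx.1 hx.2] with y hy using hlin y hy)
  have hslope : ∀ n, ∀ x ∈ Ioo 0 ε, ∃ a b, HasSlopes h (f^[n] x) a b := by
    intro n x hx
    induction n with
    | zero => exact ⟨l, l, hsmall x hx⟩
    | succ n ih =>
      have hy : f^[n] x ∈ Ioo (0 : ℝ) 1 := hf.1.mapsTo.iterate n ⟨hx.1, hx.2.trans hε.2⟩
      rw [iterate_succ_apply']
      set y := f^[n] x
      obtain ⟨a, b, h1⟩ := ih
      obtain ⟨c, d, h2⟩ := hf.1.exists_hasSlopes hy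
      obtain ⟨c', d', h3⟩ := hg.1.exists_hasSlopes (hmaps hy)
      have h4 := h2.inverse hf.1.strictMono_invFun.monotone hf.1.continuous_invFun
        hf.1.leftInverse_invFun hf.1.rightInverse_invFun
      have h5 := h1.comp hm.monotone hc h3
      rw [← hf.1.leftInverse_invFun y] at h5
      have h6 := h4.comp hf.1.strictMono_invFun.monotone hf.1.continuous_invFun h5
      have e : (g ∘ h) ∘ invFun f = h := by
        rw [← hfg.comp_eq]
        exact funext fun z => congrArg h (hf.1.rightInverse_invFun z)
      rw [e] at h6
      exact ⟨_, _, h6⟩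
  have hpre : ∀ y ∈ Ioo (0 : ℝ) 1, ∃ n, (invFun f)^[n] y ∈ Ioo 0 ε ∧
      (n = 0 ∨ invFun f ε ≤ (invFun f)^[n] y) := by
    intro y hy
    have hex : ∃ n, (invFun f)^[n] y < ε := by
      obtain ⟨n, hn⟩ := hf.exists_iterate_invFun_lt hy.2 hε
      exact ⟨n, hn n le_rfl⟩
    classical
    refine ⟨Nat.find hex, ⟨(hf.1.mapsTo_invFun.iterate _ hy).1, Nat.find_spec hex⟩, ?_⟩
    rcases hn : Nat.find hex with _ | n
    · exact Or.inl rfl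
    · right
      rw [iterate_succ_apply']
      exact hf.1.strictMono_invFun.monotone (not_lt.1 (Nat.find_min hex (m := n) (by omega)))
  have hslopes : ∀ y ∈ Ioo (0 : ℝ) 1, ∃ a b, HasSlopes h y a b := by
    intro y hy
    obtain ⟨n, hn, -⟩ := hpre y hy
    have := hslope n _ hn
    rwa [hf.1.rightInverse_invFun.iterate n] at this
  have h0 : h 0 = 0 := hout 0 (by simp)
  have h1 : h 1 = 1 := hout 1 (by simp)
  refine ⟨h0, h1, hm.strictMonoOn _, hc.continuousOn, ?_, fun x hx => hout x fun hx' =>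
    hx (Ioo_subset_Icc_self hx'), ?_⟩
  · intro z hz
    obtain ⟨x, rfl⟩ := hsurj z
    refine ⟨x, ⟨?_, ?_⟩, rfl⟩
    · rw [← hm.le_iff_le, h0]; exact hz.1
    · rw [← hm.le_iff_le, h1]; exact hz.2
  have hε' : invFun f ε ∈ Ioo (0 : ℝ) 1 := hf.1.mapsTo_invFun hε
  obtain ⟨N₁, hN₁⟩ := hf.exists_not_isNode_iterate hε'
  obtain ⟨N₂, hN₂⟩ := hg.exists_not_isNode_iterate (hmaps hε')
  set N := max N₁ N₂ with hN
  have hinj : ∀ j, Injective ((invFun f)^[j]) := fun j =>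
    hf.1.strictMono_invFun.injective.iterate j
  have hfin : (⋃ j ∈ Finset.range (N + 1), ({y | IsNode f ((invFun f)^[j] y)} ∪
      {y | IsNode g (h ((invFun f)^[j] y))})).Finite := by
    refine Set.Finite.biUnion (Finset.finite_toSet _) fun j _ => Set.Finite.union ?_ ?_
    · exact hf.1.finite_nodes.preimage (hinj j).injOn
    · exact hg.1.finite_nodes.preimage (hm.injective.comp (hinj j)).injOn
  refine hfin.subset fun y hy => ?_
  have hy : IsNode h y := hy
  obtain ⟨n, hx, hn⟩ := hpre y hy.1
  have hyx : f^[n] ((invFun f)^[n] y) = y := hf.1.rightInverse_invFun.iterate n y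
  have hk : ∀ k < n, (invFun f)^[n - k] y = f^[k] ((invFun f)^[n] y) := by
    intro k hk
    have : n = k + (n - k) := by omega
    conv_rhs => rw [this, iterate_add_apply, hf.1.rightInverse_invFun.iterate k]
  set x := (invFun f)^[n] y with hx_def
  have hxI : x ∈ Ioo (0 : ℝ) 1 := ⟨hx.1, hx.2.trans hε.2⟩
  have hprod := fstar_iterate_mul_prod hf.1 hg.1 hm.monotone hc hmaps hslopes hfg hxI n
  rw [hyx, (hsmall x hx).fstar_eq_one, mul_one] at hprod
  have hne : fstar h y ≠ 1 := fun h1 => by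
    obtain ⟨a, b, hab⟩ := hslopes y hy.1
    exact hy.2 (hab.locallyAffineAt h1)
  by_cases hnN : n ≤ N
  · by_contra hcon
    simp only [Set.mem_iUnion, Set.mem_union, Set.mem_ofPred_eq, Finset.mem_range, not_exists,
      not_or] at hcon
    refine hne ?_
    rw [Finset.prod_eq_one, Finset.prod_eq_one, mul_one] at hprod
    · exact hprod
    · intro k hkn
      have hkn : k < n := by simpa using hkn
      have := (hcon (n - k) (by omega)).2
      rw [hk k hkn] at this
      refine hg.1.fstar_eq_one (hg.1.mapsTo.iterate k (hmaps hxI)) ?_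
      rwa [← (hfg.iterate_right k) x]
    · intro k hkn
      have hkn : k < n := by simpa using hkn
      have := (hcon (n - k) (by omega)).1
      rw [hk k hkn] at this
      exact hf.1.fstar_eq_one (hf.1.mapsTo.iterate k hxI) this
  · refine (hne ?_).elim
    have hεx : invFun f ε ≤ x := hn.resolve_left (by omega)
    rw [← hf.phi_eq_prod hxI fun k hk => hN₁ k (by omega) x hεx,
      ← hg.phi_eq_prod (hmaps hxI) fun k hk => hN₂ k (by omega) _ (hm.monotone hεx),
      hlin x ⟨hx.1.le, hx.2.le⟩, ← hphi x hx] at hprod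
    exact (mul_eq_right₀ (hf.phi_ne_zero hxI)).1 hprod

theorem phi_eq_of_semiconj {f g h : ℝ → ℝ} (hf : MemF f) (hg : MemF g) (hh : IsPLF h)
    (hfg : Semiconj h f g) {x : ℝ} (hx : x ∈ Ioo (0 : ℝ) 1) :
    phi f x = phi g (h x) * fstar h x := by
  obtain ⟨N₁, hN₁⟩ := hf.exists_phi_eq_prod hx
  obtain ⟨N₂, hN₂⟩ := hg.exists_phi_eq_prod (hh.mapsTo hx)
  obtain ⟨c, hc, hlt⟩ := hh.exists_nodes_lt
  obtain ⟨N₃, hN₃⟩ := hf.exists_lt_iterate hx hc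
  set n := max N₁ (max N₂ N₃) with hn
  have := fstar_iterate_mul_prod hf.1 hg.1 hh.strictMono.monotone hh.continuous hh.mapsTo
    (fun x hx => hh.exists_hasSlopes hx) hfg hx n
  rwa [hh.fstar_eq_one (hf.1.mapsTo.iterate n hx)
    fun h => (hN₃ n (by omega)).not_gt (hlt _ h), one_mul, ← hN₁ n (by omega),
    ← hN₂ n (by omega)] at this

theorem isConjPLF_of_alphaF_eq_of_psi_eq {f g : ℝ → ℝ} (hf : MemF f) (hg : MemF g)
    (hfn : HasNode f) (hgn : HasNode g) (hα : alphaF f = alphaF g) {p : ℝ}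
    (hp : ∀ s ∈ Ico (0 : ℝ) 1, psi f s = psi g (Int.fract (s + p))) : IsConjPLF f g := by
  have hxf := (hf.isNode_firstNode hfn).1
  have hxg := (hg.isNode_firstNode hgn).1
  have hα1 := hf.one_lt_alphaF hfn
  have hα0 : 0 < alphaF f := one_pos.trans hα1
  have hap : 0 < alphaF f ^ p := Real.rpow_pos_of_pos hα0 p
  set l := alphaF f ^ p * firstNode g / firstNode f with hl_def
  have hl : 0 < l := div_pos (mul_pos hap hxg.1) hxf.1
  set ε := min (firstNode f) (firstNode g / l) with hε_def
  have hε0 : 0 < ε := lt_min hxf.1 (div_pos hxg.1 hl)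
  have hεf : ε ≤ firstNode f := min_le_left _ _
  have hεg : l * ε ≤ firstNode g := by
    have : ε ≤ firstNode g / l := min_le_right _ _
    rwa [le_div_iff₀ hl, mul_comm] at this
  have hε1 : ε < 1 := hεf.trans_lt hxf.2
  obtain ⟨h, hm, hsurj, hmaps, hout, hlin, hfg⟩ :=
    exists_semiconj_of_linear_near_zero hf hg hl hε0 hε1 (hεg.trans_lt hxg.2) (by
      intro x hx
      rw [hf.eq_alphaF_mul hfn ⟨hx.1, hx.2.trans hεf⟩, hg.eq_alphaF_mul hgn
        ⟨mul_nonneg hl.le hx.1, (mul_le_mul_of_nonneg_left hx.2 hl.le).trans hεg⟩, hα]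
      ring)
  refine ⟨h, isPLF_of_semiconj hf hg hl ⟨hε0, hε1⟩ hm hsurj hmaps hout hlin hfg ?_, ?_⟩
  · intro x hx
    set s := Real.logb (alphaF f) (x / firstNode f) with hs
    have hpow : alphaF f ^ s = x / firstNode f :=
      Real.rpow_logb hα0 hα1.ne' (div_pos hx.1 hxf.1)
    have hx_eq : x = alphaF f ^ s * firstNode f := by
      rw [hpow, div_mul_cancel₀ _ hxf.1.ne']
    have hlx_eq : l * x = alphaF g ^ (s + p) * firstNode g := by
      rw [← hα, Real.rpow_add hα0, hpow, hl_def]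
      ring
    have hs0 : s ≤ 0 := Real.logb_nonpos hα1 (div_nonneg hx.1.le hxf.1.le)
      ((div_le_one hxf.1).2 (hx.2.le.trans hεf))
    have hsp : s + p ≤ 0 := by
      have h1 : alphaF f ^ (s + p) ≤ 1 := by
        have h2 := (mul_le_mul_of_nonneg_left hx.2.le hl.le).trans hεg
        rw [hlx_eq, ← hα] at h2
        exact (mul_le_iff_le_one_left hxg.1).1 h2
      by_contra! hn
      exact (Real.one_lt_rpow hα1 hn).not_ge h1
    rw [hlx_eq, hg.phi_alphaF_rpow hgn hsp, hx_eq, hf.phi_alphaF_rpow hfn hs0,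
      hp _ ⟨Int.fract_nonneg s, Int.fract_lt_one s⟩]
    congr 1
    rw [Int.fract_eq_fract]
    exact ⟨-⌊s⌋, by rw [← Int.self_sub_floor]; push_cast; ring⟩
  · rw [← comp_assoc, hfg.comp_eq, comp_assoc]
    exact funext fun z => congrArg g (Function.rightInverse_invFun hsurj z)

theorem alphaF_eq_and_exists_psi_eq_of_isConjPLF {f g : ℝ → ℝ} (hf : MemF f) (hg : MemF g)
    (hfn : HasNode f) (hgn : HasNode g) (hconj : IsConjPLF f g) :
    alphaF f = alphaF g ∧
      ∃ p : ℝ, ∀ s ∈ Ico (0 : ℝ) 1, psi f s = psi g (Int.fract (s + p)) := by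
  obtain ⟨h, hh, hg_eq⟩ := hconj
  have hfg : Semiconj h f g := fun x => by
    rw [← hg_eq]
    simp [hh.leftInverse_invFun x]
  have hxf := (hf.isNode_firstNode hfn).1
  have hxg := (hg.isNode_firstNode hgn).1
  have hα1 := hf.one_lt_alphaF hfn
  have hα0 : 0 < alphaF f := one_pos.trans hα1
  obtain ⟨l, δ, hl, hδ, hlin⟩ := hh.exists_eq_mul_near_zero
  have hα : alphaF f = alphaF g := by
    obtain ⟨x, hx0, hx⟩ := exists_between
      (lt_min (lt_min hxf.1 (div_pos hδ hα0)) (lt_min hδ (div_pos hxg.1 hl)))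
    simp only [lt_min_iff, lt_div_iff₀ hα0, lt_div_iff₀ hl] at hx
    obtain ⟨⟨hx1, hx2⟩, hx3, hx4⟩ := hx
    have := hfg x
    rw [hf.eq_alphaF_mul hfn ⟨hx0.le, hx1.le⟩, hlin x ⟨hx0.le, hx3.le⟩,
      hlin _ ⟨by positivity, by linarith⟩,
      hg.eq_alphaF_mul hgn ⟨by positivity, by linarith⟩] at this
    have hlx : l * x ≠ 0 := by positivity
    exact mul_right_cancel₀ hlx (by linarith)
  refine ⟨hα, Real.logb (alphaF f) (l * firstNode f / firstNode g), fun s hs => ?_⟩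
  set p := Real.logb (alphaF f) (l * firstNode f / firstNode g) with hp
  have hpow : alphaF f ^ p = l * firstNode f / firstNode g :=
    Real.rpow_logb hα0 hα1.ne' (div_pos (mul_pos hl hxf.1) hxg.1)
  have ht : Tendsto (fun m : ℕ => alphaF f ^ (s - m) * firstNode f) atTop (𝓝 0) := by
    have h1 := (tendsto_pow_atTop_nhds_zero_of_lt_one (inv_nonneg.2 hα0.le)
      (inv_lt_one_of_one_lt₀ hα1)).const_mul (alphaF f ^ s * firstNode f)
    rw [mul_zero] at h1
    refine h1.congr fun m => ?_
    rw [Real.rpow_sub hα0, Real.rpow_natCast, inv_pow]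
    ring
  obtain ⟨m, hm1, hm2⟩ := ((ht.eventually (gt_mem_nhds hδ)).and
    (eventually_ge_atTop (⌈|s| + |p|⌉₊))).exists
  have hm3 : |s| + |p| ≤ m := Nat.ceil_le.1 hm2
  have hsm : s - m ≤ 0 := by linarith [le_abs_self s, abs_nonneg p]
  have hspm : s - m + p ≤ 0 := by linarith [le_abs_self s, le_abs_self p]
  have hψf := hf.phi_alphaF_rpow hfn hsm
  have hψg := hg.phi_alphaF_rpow hgn hspm
  set x := alphaF f ^ (s - m) * firstNode f with hx_def
  have hx0 : 0 < x := mul_pos (Real.rpow_pos_of_pos hα0 _) hxf.1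
  have hx1 : x < 1 :=
    (mul_le_of_le_one_left hxf.1.le (Real.rpow_le_one_of_one_le_of_nonpos hα1.le hsm)).trans_lt
      hxf.2
  have hlx : alphaF g ^ (s - m + p) * firstNode g = l * x := by
    rw [← hα, Real.rpow_add hα0, hpow, hx_def]
    have := hxg.1.ne'
    field_simp
  have hfs : fstar h x = 1 :=
    (HasSlopes.of_eventually_eq_mul hl (by
      filter_upwards [Icc_mem_nhds hx0 hm1] with y hy using hlin y hy)).fstar_eq_one
  have := phi_eq_of_semiconj hf hg hh hfg ⟨hx0, hx1⟩
  rw [hfs, mul_one, hlin x ⟨hx0.le, hm1.le⟩, ← hlx, hψf, hψg, Int.fract_sub_natCast,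
    Int.fract_eq_self.2 hs, sub_add_eq_add_sub, Int.fract_sub_natCast] at this
  exact this

/-- **Theorem (Brin–Squier classification in `𝓕`).**
`f, g ∈ 𝓕`, each with at least one node, are conjugate in `PLF⁺([0,1])` iff
`α_f = α_g` and `β_f = β_g`, i.e. there is `p ∈ ℝ` with
`ψ_f(s) = ψ_g(s + p mod 1)` for all `s` in the circle `𝕊`. -/
theorem conj_iff_alpha_and_beta (f g : ℝ → ℝ)
    (hf : MemF f) (hg : MemF g) (hfn : HasNode f) (hgn : HasNode g) :
    IsConjPLF f g ↔
      (alphaF f = alphaF g ∧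
        ∃ p : ℝ, ∀ s ∈ Set.Ico (0 : ℝ) 1, psi f s = psi g (Int.fract (s + p))) := by
  constructor
  · exact alphaF_eq_and_exists_psi_eq_of_isConjPLF hf hg hfn hgn
  · rintro ⟨hα, p, hp⟩
    exact isConjPLF_of_alphaF_eq_of_psi_eq hf hg hfn hgn hα hp
end

section
/- Let f ∈ 𝓕 have at least one node, and let n be a positive integer. Setting b = f⁻ⁿ(x_f), one has ψ_f^b(s) = ψ_f(s) for all s ∈ 𝕊. -/
open Set Function

theorem LocallyAffineAt.deriv_eventually_const {f : ℝ → ℝ} {x : ℝ} (h : LocallyAffineAt f x) :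
    ∃ a : ℝ, (∀ᶠ y in nhds x, HasDerivAt f a y) := by
  obtain ⟨a, b, hab⟩ := h
  refine ⟨a, hab.eventually_nhds.mono fun y hy => ?_⟩
  have h1 : HasDerivAt (fun y : ℝ => a * y + b) a y := by
    simpa using ((hasDerivAt_id y).const_mul a).add_const b
  exact h1.congr_of_eventuallyEq hy

theorem exists_affine_of_locallyAffineAt {f : ℝ → ℝ} {u v : ℝ}
    (h : ∀ x ∈ Ioo u v, LocallyAffineAt f x) : ∃ c d : ℝ, ∀ x ∈ Ioo u v, f x = c * x + d := by
  have hder : ∀ x ∈ Ioo u v, HasDerivAt f (deriv f x) x := fun x hx => by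
    obtain ⟨a, ha⟩ := (h x hx).deriv_eventually_const
    exact ha.self_of_nhds.differentiableAt.hasDerivAt
  have hder2 : ∀ x ∈ Ioo u v, HasDerivAt (deriv f) 0 x := fun x hx => by
    obtain ⟨a, ha⟩ := (h x hx).deriv_eventually_const
    exact (hasDerivAt_const x a).congr_of_eventuallyEq (ha.mono fun y hy => hy.deriv)
  obtain ⟨c, hc⟩ := isOpen_Ioo.exists_is_const_of_deriv_eq_zero isPreconnected_Ioo
    (fun x hx => (hder2 x hx).differentiableAt.differentiableWithinAt)
    (fun x hx => (hder2 x hx).deriv)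
  have hsub : ∀ x ∈ Ioo u v, HasDerivAt (fun y => f y - c * y) 0 x := fun x hx => by
    have hlin : HasDerivAt (fun y : ℝ => c * y) c x := by
      simpa using (hasDerivAt_id x).const_mul c
    have hsub := (hder x hx).sub hlin
    rwa [hc x hx, sub_self] at hsub
  obtain ⟨d, hd⟩ := isOpen_Ioo.exists_is_const_of_deriv_eq_zero isPreconnected_Ioo
    (fun x hx => (hsub x hx).differentiableAt.differentiableWithinAt)
    (fun x hx => (hsub x hx).deriv)
  exact ⟨c, d, fun x hx => by linarith [hd x hx]⟩

theorem IsPLF.injective {f : ℝ → ℝ} (hf : IsPLF f) : Injective f := by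
  have hmaps : MapsTo f (Icc 0 1) (Icc 0 1) := fun x hx =>
    ⟨by simpa [hf.map_zero] using hf.strictMonoOn.monotoneOn (left_mem_Icc.2 zero_le_one) hx hx.1,
     by simpa [hf.map_one] using hf.strictMonoOn.monotoneOn hx (right_mem_Icc.2 zero_le_one) hx.2⟩
  intro x y hxy
  by_cases hx : x ∈ Icc (0 : ℝ) 1 <;> by_cases hy : y ∈ Icc (0 : ℝ) 1
  · exact hf.strictMonoOn.injOn hx hy hxy
  · rw [hf.eq_id y hy] at hxy
    exact absurd (hxy ▸ hmaps hx) hy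
  · rw [hf.eq_id x hx] at hxy
    exact absurd (hxy ▸ hmaps hy) hx
  · rwa [hf.eq_id x hx, hf.eq_id y hy] at hxy

theorem IsPLF.isNode_firstNode {f : ℝ → ℝ} (hf : IsPLF f) (hfn : HasNode f) :
    IsNode f (firstNode f) :=
  Nonempty.csInf_mem (s := {x | IsNode f x}) hfn hf.finite_nodes

theorem IsPLF.locallyAffineAt_of_lt_firstNode {f : ℝ → ℝ} (hf : IsPLF f) (hfn : HasNode f)
    {x : ℝ} (hx : x ∈ Ioo 0 (firstNode f)) : LocallyAffineAt f x := by
  by_contra hna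
  have hnode : IsNode f x := ⟨⟨hx.1, hx.2.trans (hf.isNode_firstNode hfn).1.2⟩, hna⟩
  exact (csInf_le hf.finite_nodes.bddBelow hnode).not_gt hx.2

theorem IsPLF.apply_eq_alphaF_mul {f : ℝ → ℝ} (hf : IsPLF f) (hfn : HasNode f) :
    ∀ x ∈ Icc 0 (firstNode f), f x = alphaF f * x := by
  obtain ⟨hpos, hlt⟩ := (hf.isNode_firstNode hfn).1
  obtain ⟨c, d, hcd⟩ := exists_affine_of_locallyAffineAt
    fun x hx => hf.locallyAffineAt_of_lt_firstNode hfn (x := x) hx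
  have hcl : EqOn f (fun x => c * x + d) (Icc 0 (firstNode f)) := by
    refine EqOn.of_subset_closure (s := Ioo 0 (firstNode f)) hcd
      (hf.continuousOn.mono (Icc_subset_Icc_right hlt.le)) (by fun_prop) Ioo_subset_Icc_self ?_
    rw [closure_Ioo hpos.ne]
  have hd : d = 0 := by
    simpa [hf.map_zero] using (hcl (left_mem_Icc.2 hpos.le)).symm
  have hc : alphaF f = c := by
    have hderiv : HasDerivWithinAt (fun x => c * x + d) c (Iic (firstNode f)) (firstNode f) := by
      simpa using (((hasDerivAt_id (firstNode f)).const_mul c).add_const d).hasDerivWithinAt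
    refine (hderiv.congr_of_eventuallyEq ?_ (hcl (right_mem_Icc.2 hpos.le))).derivWithin
      (uniqueDiffWithinAt_Iic _)
    filter_upwards [self_mem_nhdsWithin, mem_nhdsWithin_of_mem_nhds (Ioi_mem_nhds hpos)]
      with x hx hx0 using hcl ⟨le_of_lt hx0, hx⟩
  intro x hx
  simpa [hc, hd] using hcl hx

theorem MemF.one_lt_alphaF_s1 {f : ℝ → ℝ} (hf : MemF f) (hfn : HasNode f) : 1 < alphaF f := by
  have hx := (hf.1.isNode_firstNode hfn).1
  have h := hf.2 _ hx
  rw [hf.1.apply_eq_alphaF_mul hfn _ (right_mem_Icc.2 hx.1.le)] at h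
  nlinarith [hx.1]

theorem fstar_eq_one_of_hasDerivAt {f : ℝ → ℝ} {x c : ℝ} (h : HasDerivAt f c x) (hc : c ≠ 0) :
    fstar f x = 1 := by
  rw [fstar, rightDeriv, leftDeriv,
    h.hasDerivWithinAt.derivWithin (uniqueDiffWithinAt_Ici x),
    h.hasDerivWithinAt.derivWithin (uniqueDiffWithinAt_Iic x), div_self hc]

theorem phi_apply_of_fstar_eq_one {f : ℝ → ℝ} {x : ℝ} (h : fstar f x = 1) :
    phi f (f x) = phi f x := by
  refine Function.Injective.tprod_eq (f := fun n => fstar f (f^[n] x)) Nat.succ_injective ?_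
  rintro (_ | n) hm
  · exact absurd h hm
  · exact ⟨n, rfl⟩

theorem MemF.phi_alphaF_mul {f : ℝ → ℝ} (hf : MemF f) (hfn : HasNode f) {x : ℝ}
    (hx : x ∈ Ioo 0 (firstNode f)) : phi f (alphaF f * x) = phi f x := by
  have heq := hf.1.apply_eq_alphaF_mul hfn
  rw [← heq x (Ioo_subset_Icc_self hx)]
  have hder : HasDerivAt f (alphaF f) x := by
    have h : HasDerivAt (fun y => alphaF f * y) (alphaF f) x := by
      simpa using (hasDerivAt_id x).const_mul (alphaF f)
    refine h.congr_of_eventuallyEq ?_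
    filter_upwards [Ioo_mem_nhds hx.1 hx.2] with y hy using heq y (Ioo_subset_Icc_self hy)
  exact phi_apply_of_fstar_eq_one
    (fstar_eq_one_of_hasDerivAt hder (zero_lt_one.trans (hf.one_lt_alphaF_s1 hfn)).ne')

theorem MemF.invFun_iterate_firstNode {f : ℝ → ℝ} (hf : MemF f) (hfn : HasNode f) (n : ℕ) :
    (invFun f)^[n] (firstNode f) = firstNode f / alphaF f ^ n := by
  have hα := hf.one_lt_alphaF_s1 hfn
  have hα0 : 0 < alphaF f := zero_lt_one.trans hα
  have hpos := (hf.1.isNode_firstNode hfn).1.1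
  induction n with
  | zero => simp
  | succ n ih =>
    have happ : f (firstNode f / alphaF f ^ (n + 1)) = firstNode f / alphaF f ^ n := by
      rw [hf.1.apply_eq_alphaF_mul hfn _
        ⟨by positivity, div_le_self hpos.le (one_le_pow₀ hα.le)⟩]
      rw [pow_succ']
      field_simp
    rw [iterate_succ_apply', ih, ← happ, leftInverse_invFun hf.1.injective]

/-- **Lemma 1, first part.** For `f ∈ 𝓕` with at least one node, a positive integer `n`
and `b = f⁻ⁿ(x_f)`, one has `ψ_f^b = ψ_f` on the circle `𝕊`. -/
theorem psiA_preimage_eq_psi (f : ℝ → ℝ) (hf : MemF f) (hfn : HasNode f)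
    (n : ℕ) (hn : 0 < n) (b : ℝ) (hb : b = (Function.invFun f)^[n] (firstNode f)) :
    ∀ s ∈ Set.Ico (0 : ℝ) 1, psiA f b s = psi f s := by
  intro s hs
  have hα := hf.one_lt_alphaF_s1 hfn
  have hα0 : 0 < alphaF f := zero_lt_one.trans hα
  have hpos := (hf.1.isNode_firstNode hfn).1.1
  rw [hb, hf.invFun_iterate_firstNode hfn, psi, psiA, psiA]
  clear hb hn
  induction n with
  | zero => simp
  | succ n ih =>
    have hs1 : alphaF f ^ s < alphaF f ^ (n + 1) :=
      (Real.rpow_lt_rpow_of_exponent_lt hα hs.2).trans_le <| by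
        simpa using pow_le_pow_right₀ hα.le (Nat.le_add_left 1 n)
    have hmem : alphaF f ^ s * (firstNode f / alphaF f ^ (n + 1)) ∈ Ioo 0 (firstNode f) := by
      refine ⟨by positivity, ?_⟩
      rw [← mul_div_assoc, div_lt_iff₀ (by positivity), mul_comm]
      exact mul_lt_mul_of_pos_left hs1 hpos
    rw [← ih, ← hf.phi_alphaF_mul hfn hmem]
    congr 1
    rw [pow_succ']
    field_simp
end
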